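/- arXiv:1807.03050 — 3 statements merged into one kernel-verified Lean document; each statement's English description precedes it below -/
import Mathlib

section
/- Let a, b be integers with 2 ≤ b < a and suppose the polynomial P(X) = X^3 − aX^2 + bX − 1 has three real roots β, β', β'' with β > 1, 0 < β' < 1 and 0 < β'' < 1. Then 1 ≤ L_⊕(β) ≤ 2. -/
open Polynomial

/-- The β-transformation `T_β(x) = βx - ⌊βx⌋`. -/
noncomputable def betaT (β : ℝ) : ℝ → ℝ := fun x => β * x - ⌊β * x⌋

/-- `fin(β)`: reals `x` such that `|x|/β^N ∈ [0,1)` and the greedy expansion of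
`|x|/β^N` is finite, for some `N, n ∈ ℕ`. -/
def finBeta (β : ℝ) : Set ℝ :=
  {x | ∃ N n : ℕ, |x| / β ^ N ∈ Set.Ico (0 : ℝ) 1 ∧ (betaT β)^[n] (|x| / β ^ N) = 0}

/-- `ℤ_β`: the set of β-integers. -/
def betaInt (β : ℝ) : Set ℝ :=
  {x | ∃ N : ℕ, |x| / β ^ N ∈ Set.Ico (0 : ℝ) 1 ∧ (betaT β)^[N] (|x| / β ^ N) = 0}

/-- `L_⊕(β)`: the least `L ∈ ℕ` such that `β^L·(x+y) ∈ ℤ_β` for all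
`x, y ∈ ℤ_β` with `x + y ∈ fin(β)`. -/
noncomputable def Lplus (β : ℝ) : ℕ :=
  sInf {L : ℕ | ∀ x ∈ betaInt β, ∀ y ∈ betaInt β,
    x + y ∈ finBeta β → β ^ L * (x + y) ∈ betaInt β}

/-- `L_⊗(β)`: the least `L ∈ ℕ` such that `β^L·(x·y) ∈ ℤ_β` for all
`x, y ∈ ℤ_β` with `x·y ∈ fin(β)`. -/
noncomputable def Lmul (β : ℝ) : ℕ :=
  sInf {L : ℕ | ∀ x ∈ betaInt β, ∀ y ∈ betaInt β,
    x * y ∈ finBeta β → β ^ L * (x * y) ∈ betaInt β}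

theorem betaT_eq {β w t : ℝ} (d : ℤ) (h : β * w = d + t) (ht : 0 ≤ t) (ht1 : t < 1) :
    betaT β w = t := by
  have hd : ⌊β * w⌋ = d := Int.floor_eq_iff.mpr ⟨by linarith, by linarith⟩
  simp only [betaT, hd]
  linarith

theorem betaT_iterate_succ_eq {β w t : ℝ} {n : ℕ} (d : ℤ) (h : β * w = d + t) (ht : 0 ≤ t)
    (ht1 : t < 1) : (betaT β)^[n + 1] w = (betaT β)^[n] t := by
  rw [Function.iterate_succ_apply, betaT_eq d h ht ht1]

theorem betaT_zero (β : ℝ) : betaT β 0 = 0 := by simp [betaT]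

theorem betaT_iterate_mem (β : ℝ) {w : ℝ} (hw : w ∈ Set.Ico (0 : ℝ) 1) (n : ℕ) :
    (betaT β)^[n] w ∈ Set.Ico (0 : ℝ) 1 := by
  cases n with
  | zero => exact hw
  | succ n =>
    rw [Function.iterate_succ_apply']
    exact ⟨Int.fract_nonneg _, Int.fract_lt_one _⟩

theorem betaT_iterate_eq_zero_of_le {β w : ℝ} {m n : ℕ} (hmn : m ≤ n)
    (h : (betaT β)^[m] w = 0) : (betaT β)^[n] w = 0 := by
  obtain ⟨k, rfl⟩ := Nat.exists_eq_add_of_le' hmn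
  rw [Function.iterate_add_apply, h]
  exact Function.iterate_fixed (betaT_zero β) k

/-- Prepending zeros to the greedy expansion does not change the fractional part. -/
theorem betaT_iterate_div_pow_add {β z : ℝ} (hβ : 1 < β) (hz : 0 ≤ z) {N : ℕ}
    (hzN : z < β ^ N) (k : ℕ) :
    (betaT β)^[N + k] (z / β ^ (N + k)) = (betaT β)^[N] (z / β ^ N) := by
  have hβ0 : 0 < β := by linarith
  induction k with
  | zero => rfl
  | succ k ih =>
    rw [← add_assoc, betaT_iterate_succ_eq (t := z / β ^ (N + k)) 0, ih]
    · rw [pow_succ]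
      field_simp
      simp
    · positivity
    · rw [div_lt_one (by positivity)]
      exact hzN.trans_le (pow_le_pow_right₀ hβ.le (by omega))

/-- The integer part of a greedy expansion is the value at `β` of an integer polynomial with
nonnegative bounded coefficients, which controls its value at `u ∈ (0, 1)`. -/
theorem exists_digit_polynomial {β u : ℝ} {a : ℤ} (hβ : 0 < β) (hβa : β < a)
    (hu : u ∈ Set.Ioo (0 : ℝ) 1) {w : ℝ} (hw : w ∈ Set.Ico (0 : ℝ) 1) (n : ℕ) :
    ∃ F : ℤ[X], aeval β F = β ^ n * w - (betaT β)^[n] w ∧ 0 ≤ aeval u F ∧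
      aeval u F * (1 - u) ≤ a - 1 := by
  obtain ⟨hu0, hu1⟩ := hu
  induction n with
  | zero =>
    have : (1 : ℝ) ≤ a := by
      have : (0 : ℝ) < a := by linarith
      exact_mod_cast (by exact_mod_cast this : (0 : ℤ) < a)
    exact ⟨0, by simp, by simp, by simpa using this⟩
  | succ n ih =>
    obtain ⟨F, hF, hF0, hF1⟩ := ih
    obtain ⟨ht0, ht1⟩ := betaT_iterate_mem β hw n
    set t := (betaT β)^[n] w with ht
    have hd0 : (0 : ℤ) ≤ ⌊β * t⌋ := Int.floor_nonneg.mpr (by positivity)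
    have hd1 : ⌊β * t⌋ ≤ a - 1 := by
      have : ⌊β * t⌋ < a := Int.floor_lt.mpr (by nlinarith)
      omega
    have hd0' : (0 : ℝ) ≤ ⌊β * t⌋ := by exact_mod_cast hd0
    have hd1' : (⌊β * t⌋ : ℝ) ≤ a - 1 := by exact_mod_cast hd1
    refine ⟨X * F + C ⌊β * t⌋, ?_, ?_, ?_⟩
    · rw [Function.iterate_succ_apply', ← ht]
      simp only [map_add, map_mul, aeval_X, hF, betaT, eq_intCast, map_intCast]
      ring
    · simp only [map_add, map_mul, aeval_X, eq_intCast, map_intCast]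
      positivity
    · simp only [map_add, map_mul, aeval_X, eq_intCast, map_intCast]
      nlinarith

theorem exists_polynomial_of_mem_betaInt {β u : ℝ} {a : ℤ} (hβ : 0 < β) (hβa : β < a)
    (hu : u ∈ Set.Ioo (0 : ℝ) 1) {x : ℝ} (hx : x ∈ betaInt β) :
    ∃ F : ℤ[X], aeval β F = x ∧ |aeval u F| * (1 - u) ≤ a - 1 := by
  obtain ⟨N, hN, hT⟩ := hx
  obtain ⟨F, hF, hF0, hF1⟩ := exists_digit_polynomial hβ hβa hu hN N
  have hF' : aeval β F = |x| := by
    rw [hF, hT, sub_zero]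
    field_simp
  rcases abs_cases x with ⟨h, _⟩ | ⟨h, _⟩
  · exact ⟨F, by rw [hF', h], by rwa [abs_of_nonneg hF0]⟩
  · exact ⟨-F, by rw [map_neg, hF', h, neg_neg], by rwa [map_neg, abs_neg, abs_of_nonneg hF0]⟩

/-- A number in `fin(β)` which is not a β-integer after scaling by `β ^ L` has a nonzero digit at
position below `-L`. -/
theorem exists_polynomial_of_mem_finBeta {β u : ℝ} {a : ℤ} (hβ : 0 < β) (hβa : β < a)
    (hu : u ∈ Set.Ioo (0 : ℝ) 1) {z : ℝ} (hz : z ∈ finBeta β) {L : ℕ}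
    (hL : β ^ L * z ∉ betaInt β) :
    ∃ (m : ℕ) (G : ℤ[X]), L < m ∧ aeval β G = β ^ m * z ∧ 1 ≤ |aeval u G| := by
  classical
  obtain ⟨N, n, hN, hn⟩ := hz
  have hex : ∃ n, (betaT β)^[n] (|z| / β ^ N) = 0 := ⟨n, hn⟩
  have hscale : |β ^ L * z| / β ^ (N + L) = |z| / β ^ N := by
    rw [abs_mul, abs_of_pos (pow_pos hβ L), pow_add]
    field_simp
  have hlt : N + L < Nat.find hex := by
    by_contra! h
    refine hL ⟨N + L, by rwa [hscale], ?_⟩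
    rw [hscale]
    exact betaT_iterate_eq_zero_of_le h (Nat.find_spec hex)
  obtain ⟨k, hk⟩ : ∃ k, Nat.find hex = k + 1 := ⟨Nat.find hex - 1, by omega⟩
  have hzero := Nat.find_spec hex
  have hne : (betaT β)^[k] (|z| / β ^ N) ≠ 0 := Nat.find_min hex (by omega)
  rw [hk, Function.iterate_succ_apply'] at hzero
  obtain ⟨F, hF, hF0, -⟩ := exists_digit_polynomial hβ hβa hu hN k
  have ht0 := (betaT_iterate_mem β hN k).1
  set t := (betaT β)^[k] (|z| / β ^ N)
  have hdt : β * t = ⌊β * t⌋ := sub_eq_zero.mp hzero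
  have hd : (1 : ℝ) ≤ ⌊β * t⌋ := by
    have hpos : (0 : ℝ) < ⌊β * t⌋ := by
      rw [← hdt]
      exact mul_pos hβ (lt_of_le_of_ne ht0 hne.symm)
    exact_mod_cast (by exact_mod_cast hpos : (0 : ℤ) < ⌊β * t⌋)
  obtain ⟨m, hm⟩ : ∃ m, k + 1 = m + N := ⟨k + 1 - N, by omega⟩
  have hG : aeval β (X * F + C ⌊β * t⌋) = β ^ m * |z| := by
    simp only [map_add, map_mul, aeval_X, hF, eq_intCast, map_intCast, ← hdt]
    calc β * (β ^ k * (|z| / β ^ N) - t) + β * t = β ^ (k + 1) * (|z| / β ^ N) := by ring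
      _ = β ^ m * |z| := by
        rw [hm, pow_add]
        field_simp
  have hG1 : 1 ≤ |aeval u (X * F + C ⌊β * t⌋)| := by
    refine le_trans ?_ (le_abs_self _)
    simp only [map_add, map_mul, aeval_X, eq_intCast, map_intCast]
    nlinarith [mul_nonneg hu.1.le hF0]
  rcases abs_cases z with ⟨h, _⟩ | ⟨h, _⟩
  · exact ⟨m, _, by omega, by rw [hG, h], hG1⟩
  · exact ⟨m, -(X * F + C ⌊β * t⌋), by omega, by rw [map_neg, hG, h]; ring,
      by rwa [map_neg, abs_neg]⟩

/-- The cubic `X³ - aX² + bX - 1` is irreducible, so an integer polynomial vanishing at one real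
root vanishes at all of them. -/
theorem aeval_eq_zero_of_conjugate {a b : ℤ} (hb : 2 ≤ b) (hba : b < a) {β u : ℝ}
    (hβ : β ^ 3 - a * β ^ 2 + b * β - 1 = 0) (hu : u ^ 3 - a * u ^ 2 + b * u - 1 = 0)
    {F : ℤ[X]} (hF : aeval β F = 0) : aeval u F = 0 := by
  set P : ℤ[X] := X ^ 3 - C a * X ^ 2 + C b * X - 1 with hP
  have hdeg : P.natDegree = 3 := by
    rw [hP]
    compute_degree!
  have hmonic : P.Monic := by
    rw [hP]
    monicity!
  have hirr : Irreducible P := by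
    rw [hmonic.irreducible_iff_roots_eq_zero_of_degree_le_three (by omega) (by omega)]
    refine Multiset.eq_zero_of_forall_notMem fun r hr => ?_
    have hr0 : r ^ 3 - a * r ^ 2 + b * r - 1 = 0 := by
      simpa [hP] using (mem_roots'.mp hr).2
    have hr1 : IsUnit r := .of_mul_eq_one (r ^ 2 - a * r + b) (by linarith)
    rcases Int.isUnit_iff.mp hr1 with rfl | rfl <;> norm_num at hr0 <;> omega
  have hPβ : aeval β P = 0 := by simpa [hP] using hβ
  have hPu : aeval u P = 0 := by simpa [hP] using hu
  have hint : IsIntegral ℤ β := ⟨P, hmonic, by simpa [aeval_def] using hPβ⟩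
  have hassoc : P ∣ minpoly ℤ β := by
    rcases hirr.dvd_iff.mp (minpoly.isIntegrallyClosed_dvd hint hPβ) with h | h
    · exact absurd h (minpoly.not_isUnit ℤ β)
    · exact h.dvd
  obtain ⟨Q, rfl⟩ := hassoc.trans (minpoly.isIntegrallyClosed_dvd hint hF)
  simp [hPu]

theorem sub_one_lt_root {a b : ℤ} (hb : 2 ≤ b) (hba : b < a) {β u v : ℝ}
    (hu : u ∈ Set.Ioo (0 : ℝ) 1) (hv : v ∈ Set.Ioo (0 : ℝ) 1)
    (hroots : ∀ x : ℝ, x ^ 3 - (a : ℝ) * x ^ 2 + (b : ℝ) * x - 1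
      = (x - β) * (x - u) * (x - v)) : (a : ℝ) - 1 < β := by
  have hb' : (2 : ℝ) ≤ b := by exact_mod_cast hb
  have hba' : (b : ℝ) + 1 ≤ a := by exact_mod_cast hba
  by_contra! h
  have h1 := hroots (a - 1)
  have h2 : 0 ≤ ((a : ℝ) - 1 - β) * (a - 1 - u) * (a - 1 - v) :=
    mul_nonneg (mul_nonneg (by linarith) (by linarith [hu.2])) (by linarith [hv.2])
  nlinarith

/-- The smaller conjugate `u` of `β` satisfies `2 (a - 1) / (1 - u) < u⁻³`, in polynomial form. -/
theorem smaller_conjugate_bound {a b : ℤ} (hb : 2 ≤ b) (hba : b < a) {β u v : ℝ}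
    (hu : u ∈ Set.Ioo (0 : ℝ) 1) (hv : v ∈ Set.Ioo (0 : ℝ) 1) (huv : u ≤ v)
    (hroots : ∀ x : ℝ, x ^ 3 - (a : ℝ) * x ^ 2 + (b : ℝ) * x - 1
      = (x - β) * (x - u) * (x - v)) : 2 * ((a : ℝ) - 1) * u ^ 3 < 1 - u := by
  have haβ := sub_one_lt_root hb hba hu hv hroots
  obtain ⟨hu0, hu1⟩ := hu
  obtain ⟨hv0, hv1⟩ := hv
  have hb' : (2 : ℝ) ≤ b := by exact_mod_cast hb
  have hba' : (b : ℝ) + 1 ≤ a := by exact_mod_cast hba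
  have hprod : β * (u * v) = 1 := by linear_combination hroots 0
  have hpair : β * (u + v) + u * v = b := by
    linear_combination (hroots (-1) - hroots 1) / 2
  have hβ0 : 0 < β := by linarith
  have huu : β * u ^ 2 ≤ 1 := by
    rw [← hprod]
    have : u ^ 2 ≤ u * v := by nlinarith
    gcongr
  rcases le_or_gt 9 β with h9 | h9
  · have hu3 : u ≤ 1 / 3 := by nlinarith
    have h1 : ((a : ℝ) - 1) * u ^ 3 < β * u ^ 3 := by gcongr
    nlinarith
  · have ha9 : a ≤ 9 := by
      have : (a : ℝ) < 10 := by linarith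
      have : a < 10 := by exact_mod_cast this
      omega
    have hdisc : 4 * β ≤ ((b : ℝ) - u * v) ^ 2 := by
      have h1 : ((b : ℝ) - u * v) ^ 2 = β ^ 2 * (u - v) ^ 2 + 4 * β * (β * (u * v)) := by
        rw [← hpair]
        ring
      rw [h1, hprod]
      nlinarith [mul_nonneg (sq_nonneg β) (sq_nonneg (u - v))]
    set p := u * v with hp
    have hp0 : 0 < p := by positivity
    have hp1 : p < 1 := by nlinarith
    have hb4 : 4 < b := by
      have : (4 : ℝ) < b := by nlinarith
      exact_mod_cast this
    have hcase : 6 ≤ b ∨ b = 5 ∧ a = 6 := by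
      by_contra! h
      have h5 : b = 5 := by omega
      have ha7 : 7 ≤ a := by have := h.2 h5; omega
      have ha7' : (7 : ℝ) ≤ a := by exact_mod_cast ha7
      have hb5 : (b : ℝ) = 5 := by exact_mod_cast h5
      rw [hb5] at hdisc
      have hp6 : p < 1 / 6 := by nlinarith
      have h4 : 4 ≤ p * (5 - p) ^ 2 := by nlinarith
      nlinarith [sq_nonneg p, mul_pos hp0 hp0]
    have hval : 0 < (1 : ℝ) / 27 - a / 9 + b / 3 - 1 := by
      have : 3 * b ≥ 9 + a := by omega
      have : (3 : ℝ) * b ≥ 9 + a := by exact_mod_cast this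
      linarith
    have hu3 : u < 1 / 3 := by
      by_contra! h
      have h1 := hroots (1 / 3)
      have h2 : 0 ≤ (u - 1 / 3) * (v - 1 / 3) := mul_nonneg (by linarith) (by linarith)
      have h3 : 0 ≤ (β - 1 / 3) * ((u - 1 / 3) * (v - 1 / 3)) :=
        mul_nonneg (by linarith) h2
      nlinarith
    have ha9' : (a : ℝ) ≤ 9 := by exact_mod_cast ha9
    have hu2 : u ^ 2 < 1 / 9 := by nlinarith
    have h1 : ((a : ℝ) - 1) * u ^ 3 ≤ 8 * u ^ 3 := by gcongr; linarith
    nlinarith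

theorem two_scaling_mem {a b : ℤ} (hb : 2 ≤ b) (hba : b < a) {β u v : ℝ}
    (hu : u ∈ Set.Ioo (0 : ℝ) 1) (hv : v ∈ Set.Ioo (0 : ℝ) 1) (huv : u ≤ v)
    (hroots : ∀ x : ℝ, x ^ 3 - (a : ℝ) * x ^ 2 + (b : ℝ) * x - 1
      = (x - β) * (x - u) * (x - v)) {x y : ℝ} (hx : x ∈ betaInt β) (hy : y ∈ betaInt β)
    (hxy : x + y ∈ finBeta β) : β ^ 2 * (x + y) ∈ betaInt β := by
  have haβ := sub_one_lt_root hb hba hu hv hroots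
  have hbound := smaller_conjugate_bound hb hba hu hv huv hroots
  have hb' : (2 : ℝ) ≤ b := by exact_mod_cast hb
  have hba' : (b : ℝ) + 1 ≤ a := by exact_mod_cast hba
  have hsum : β + u + v = a := by linear_combination (hroots 1 + hroots (-1) - 2 * hroots 0) / 2
  have hβ0 : 0 < β := by linarith
  have hβa : β < a := by linarith [hu.1, hv.1]
  by_contra hL
  obtain ⟨F, hF, hF1⟩ := exists_polynomial_of_mem_betaInt hβ0 hβa hu hx
  obtain ⟨F', hF', hF1'⟩ := exists_polynomial_of_mem_betaInt hβ0 hβa hu hy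
  obtain ⟨m, G, hm, hG, hG1⟩ := exists_polynomial_of_mem_finBeta hβ0 hβa hu hxy hL
  have hconj : aeval u (G - X ^ m * (F + F')) = 0 := by
    refine aeval_eq_zero_of_conjugate hb hba (β := β) ?_ ?_ ?_
    · rw [hroots]; ring
    · rw [hroots]; ring
    · simp [hG, hF, hF']
  have hGu : aeval u G = u ^ m * (aeval u F + aeval u F') := by
    simpa [sub_eq_zero] using hconj
  obtain ⟨hu0, hu1⟩ := hu
  have hpow : u ^ m ≤ u ^ 3 := pow_le_pow_of_le_one hu0.le hu1.le hm
  have habs : |aeval u F + aeval u F'| * (1 - u) ≤ 2 * (a - 1) := by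
    have := mul_le_mul_of_nonneg_right (abs_add_le (aeval u F) (aeval u F'))
      (by linarith : 0 ≤ 1 - u)
    linarith
  rw [hGu, abs_mul, abs_of_pos (pow_pos hu0 m)] at hG1
  have h1 : 1 - u ≤ u ^ m * (|aeval u F + aeval u F'| * (1 - u)) := by
    nlinarith
  have h2 : u ^ m * (|aeval u F + aeval u F'| * (1 - u)) ≤ u ^ 3 * (2 * (a - 1)) :=
    mul_le_mul hpow habs (mul_nonneg (abs_nonneg _) (by linarith)) (by positivity)
  linarith

/-- `(β³ + (b - 1)) - ((a - 1)β² + (a - b - 1)β) = β + β⁻¹` lies in `fin(β)` but not in `ℤ_β`. -/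
theorem exists_sum_not_mem_betaInt {a b : ℤ} (hb : 2 ≤ b) (hba : b < a) {β : ℝ}
    (haβ : (a : ℝ) - 1 < β) (hβ : β ^ 3 - a * β ^ 2 + b * β - 1 = 0) :
    ∃ x ∈ betaInt β, ∃ y ∈ betaInt β, x + y ∈ finBeta β ∧ x + y ∉ betaInt β := by
  have hb' : (2 : ℝ) ≤ b := by exact_mod_cast hb
  have hba' : (b : ℝ) + 1 ≤ a := by exact_mod_cast hba
  have hβ2 : 2 < β := by linarith
  have hβ0 : 0 < β := by linarith
  have hinv : β⁻¹ < 1 := inv_lt_one_of_one_lt₀ (by linarith)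
  have hx0 : (0 : ℝ) < β ^ 3 + (b - 1) := by
    have := pow_pos hβ0 3
    linarith
  have hy0 : (0 : ℝ) ≤ (a - 1) * β ^ 2 + (a - b - 1) * β := by
    have h1 : (0 : ℝ) ≤ a - 1 := by linarith
    have h2 : (0 : ℝ) ≤ a - b - 1 := by linarith
    positivity
  have hβ4 : β ^ 3 + (b - 1) < β ^ 4 := by
    have : (b : ℝ) - 1 < β := by linarith
    nlinarith [pow_pos hβ0 2, pow_pos hβ0 3]
  have hy1 : ((a : ℝ) - 1) * β ^ 2 + (a - b - 1) * β < β ^ 3 := by nlinarith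
  have hsum : β ^ 3 + ((b : ℝ) - 1) + -((a - 1) * β ^ 2 + (a - b - 1) * β) = β + β⁻¹ := by
    field_simp
    linear_combination (β + 1) * hβ
  have hz0 : 0 < β + β⁻¹ := by positivity
  have hz2 : β + β⁻¹ < β ^ 2 := by nlinarith
  have hzT : (betaT β)^[2] ((β + β⁻¹) / β ^ 2) = β⁻¹ := by
    rw [betaT_iterate_succ_eq (t := β⁻¹ / β) 1, betaT_iterate_succ_eq (t := β⁻¹) 0,
      Function.iterate_zero_apply]
    · field_simp
      simp
    · positivity
    · exact hinv
    · field_simp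
      push_cast
      ring
    · positivity
    · rw [div_lt_one hβ0]
      linarith
  refine ⟨β ^ 3 + (b - 1), ⟨4, ?_, ?_⟩, -((a - 1) * β ^ 2 + (a - b - 1) * β),
    ⟨3, ?_, ?_⟩, ?_, ?_⟩
  · rw [abs_of_pos hx0, Set.mem_Ico, div_lt_one (by positivity)]
    exact ⟨by positivity, hβ4⟩
  · have hb0 : (0 : ℝ) ≤ b - 1 := by linarith
    have hdiv (k : ℕ) (hk : k ≠ 0) : ((b : ℝ) - 1) / β ^ k < 1 := by
      rw [div_lt_one (by positivity)]
      have := le_self_pow₀ (by linarith : 1 ≤ β) hk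
      linarith
    rw [abs_of_pos hx0]
    rw [betaT_iterate_succ_eq (t := (b - 1) / β ^ 3) 1 _ (by positivity) (hdiv 3 (by norm_num)),
      betaT_iterate_succ_eq (t := (b - 1) / β ^ 2) 0 _ (by positivity) (hdiv 2 (by norm_num)),
      betaT_iterate_succ_eq (t := (b - 1) / β ^ 1) 0 _ (by positivity) (hdiv 1 (by norm_num)),
      betaT_iterate_succ_eq (t := 0) (b - 1) _ le_rfl one_pos,
      Function.iterate_zero_apply]
    all_goals
      field_simp
      push_cast
      ring
  · rw [abs_neg, abs_of_nonneg hy0, Set.mem_Ico, div_lt_one (by positivity)]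
    exact ⟨by positivity, hy1⟩
  · have hab0 : (0 : ℝ) ≤ a - b - 1 := by linarith
    rw [abs_neg, abs_of_nonneg hy0,
      betaT_iterate_succ_eq (t := (a - b - 1) / β) (a - 1) _ (by positivity),
      betaT_iterate_succ_eq (t := 0) (a - b - 1) _ le_rfl one_pos,
      Function.iterate_succ_apply, Function.iterate_zero_apply, betaT_zero]
    · field_simp
      push_cast
      ring
    · rw [div_lt_one hβ0]
      linarith
    · field_simp
      push_cast
      ring
  · rw [hsum]
    refine ⟨2, 3, ?_, ?_⟩
    · rw [abs_of_pos hz0, Set.mem_Ico, div_lt_one (by positivity)]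
      exact ⟨by positivity, hz2⟩
    · rw [abs_of_pos hz0, Function.iterate_succ_apply', hzT]
      exact betaT_eq 1 (by field_simp; simp) le_rfl one_pos
  · rw [hsum]
    rintro ⟨N, ⟨-, hN⟩, hT⟩
    rw [abs_of_pos hz0] at hN hT
    rw [div_lt_one (by positivity)] at hN
    have hN2 : 2 ≤ N := by
      by_contra! h
      have : β ^ N ≤ β ^ 1 := pow_le_pow_right₀ (by linarith) (by omega)
      have := inv_pos.mpr hβ0
      linarith
    obtain ⟨k, rfl⟩ := Nat.exists_eq_add_of_le hN2
    rw [betaT_iterate_div_pow_add (by linarith) hz0.le hz2, hzT] at hT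
    exact hβ0.ne' (inv_eq_zero.mp hT)

theorem stmt1 (a b : ℤ) (hb : 2 ≤ b) (hba : b < a) (β β' β'' : ℝ)
    (hβ : 1 < β) (hβ' : β' ∈ Set.Ioo (0 : ℝ) 1) (hβ'' : β'' ∈ Set.Ioo (0 : ℝ) 1)
    (hroots : ∀ x : ℝ, x ^ 3 - (a : ℝ) * x ^ 2 + (b : ℝ) * x - 1
      = (x - β) * (x - β') * (x - β'')) :
    1 ≤ Lplus β ∧ Lplus β ≤ 2 := by
  have hmem : 2 ∈ {L : ℕ | ∀ x ∈ betaInt β, ∀ y ∈ betaInt β,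
      x + y ∈ finBeta β → β ^ L * (x + y) ∈ betaInt β} := by
    intro x hx y hy hxy
    rcases le_total β' β'' with h | h
    · exact two_scaling_mem hb hba hβ' hβ'' h hroots hx hy hxy
    · exact two_scaling_mem hb hba hβ'' hβ' h (fun x => by rw [hroots]; ring) hx hy hxy
  refine ⟨Nat.one_le_iff_ne_zero.mpr fun h0 => ?_, Nat.sInf_le hmem⟩
  obtain ⟨x, hx, y, hy, hfin, hnot⟩ := exists_sum_not_mem_betaInt hb hba
    (sub_one_lt_root hb hba hβ' hβ'' hroots) (by rw [hroots]; ring)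
  have hzero := Nat.sInf_mem ⟨2, hmem⟩
  rw [show sInf _ = 0 from h0] at hzero
  exact hnot (by simpa using hzero x hx y hy hfin)
end

section
/- Let a, b be integers with 0 < b < a and let β be the unique real root greater than 1 of the polynomial P(X) = X^3 − aX^2 − bX + 1. If (a, b) ≠ (2, 1) then 1 ≤ L_⊕(β) ≤ 2, while if (a, b) = (2, 1) then 2 ≤ L_⊕(β) ≤ 3. -/
open Polynomial

theorem aeval_eq_zero_of_aeval_eq_zero (a b : ℤ) (hb : 0 < b) (hba : b < a) {β α : ℝ}
    (hβ : β ^ 3 - (a : ℝ) * β ^ 2 - (b : ℝ) * β + 1 = 0)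
    (hα : α ^ 3 - (a : ℝ) * α ^ 2 - (b : ℝ) * α + 1 = 0) {p : ℤ[X]} (hp : aeval β p = 0) :
    aeval α p = 0 := by
  set P : ℤ[X] := X ^ 3 - C a * X ^ 2 - C b * X + 1 with hP
  have hdeg : P.natDegree = 3 := by rw [hP]; compute_degree!
  have hmonic : P.Monic := by rw [hP]; monicity!
  have hirr : Irreducible P := by
    rw [hmonic.irreducible_iff_roots_eq_zero_of_degree_le_three (by omega) (by omega),
      Multiset.eq_zero_iff_forall_notMem]
    intro r hr
    have hr0 : r ^ 3 - a * r ^ 2 - b * r + 1 = 0 := by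
      have := (mem_roots'.1 hr).2
      simpa [hP, IsRoot] using this
    have hr1 : r ∣ 1 := ⟨-(r ^ 2 - a * r - b), by linarith⟩
    rcases Int.isUnit_iff.1 (isUnit_of_dvd_one hr1) with rfl | rfl <;> linarith
  have hPβ : aeval β P = 0 := by simpa [hP] using hβ
  have hPα : aeval α P = 0 := by simpa [hP] using hα
  have hint : IsIntegral ℤ β := ⟨P, hmonic, by simpa [aeval_def] using hPβ⟩
  have hdvd : minpoly ℤ β ∣ P := minpoly.isIntegrallyClosed_dvd hint hPβ
  have hPp : P ∣ p :=
    ((hirr.dvd_iff.1 hdvd).resolve_left (minpoly.not_isUnit ℤ β)).dvd.trans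
      (minpoly.isIntegrallyClosed_dvd hint hp)
  obtain ⟨q, rfl⟩ := hPp
  simp [hPα]

theorem betaT_nonneg (β x : ℝ) : 0 ≤ betaT β x := Int.fract_nonneg (β * x)

theorem betaT_lt_one (β x : ℝ) : betaT β x < 1 := Int.fract_lt_one (β * x)

theorem iterate_betaT_zero (β : ℝ) (n : ℕ) : (betaT β)^[n] 0 = 0 :=
  Function.iterate_fixed (betaT_zero β) n

theorem iterate_betaT_mem_Ico (β : ℝ) {t : ℝ} (ht : t ∈ Set.Ico (0 : ℝ) 1) (n : ℕ) :
    (betaT β)^[n] t ∈ Set.Ico (0 : ℝ) 1 := by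
  cases n with
  | zero => simpa using ht
  | succ n =>
    rw [Function.iterate_succ_apply']
    exact ⟨betaT_nonneg _ _, betaT_lt_one _ _⟩

theorem betaT_eq_of_mem_Ico {β x : ℝ} (d : ℤ) (h : β * x - d ∈ Set.Ico (0 : ℝ) 1) :
    betaT β x = β * x - d := by
  have : ⌊β * x⌋ = d := Int.floor_eq_iff.2 ⟨by linarith [h.1], by linarith [h.2]⟩
  simp [betaT, this]

theorem betaT_div_pow_succ {β x : ℝ} (hβ : 1 < β) {N : ℕ} (h : x / β ^ N ∈ Set.Ico (0 : ℝ) 1) :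
    betaT β (x / β ^ (N + 1)) = x / β ^ N := by
  have h1 : β * (x / β ^ (N + 1)) = x / β ^ N := by
    have : β ≠ 0 := by linarith
    field_simp
    ring
  rw [betaT_eq_of_mem_Ico 0 (by rw [h1]; simpa using h), h1]
  simp

theorem div_pow_add_mem_Ico {β x : ℝ} (hβ : 1 < β) {N : ℕ}
    (h : x / β ^ N ∈ Set.Ico (0 : ℝ) 1) (k : ℕ) : x / β ^ (N + k) ∈ Set.Ico (0 : ℝ) 1 := by
  have hk : 1 ≤ β ^ k := one_le_pow₀ hβ.le
  rw [pow_add, ← div_div]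
  exact ⟨div_nonneg h.1 (by linarith), (div_le_self h.1 hk).trans_lt h.2⟩

theorem iterate_betaT_div_pow_add {β x : ℝ} (hβ : 1 < β) {N : ℕ}
    (h : x / β ^ N ∈ Set.Ico (0 : ℝ) 1) (k : ℕ) :
    (betaT β)^[N + k] (x / β ^ (N + k)) = (betaT β)^[N] (x / β ^ N) := by
  induction k with
  | zero => rfl
  | succ k ih =>
    rw [← add_assoc, Function.iterate_succ_apply,
      betaT_div_pow_succ hβ (div_pow_add_mem_Ico hβ h k), ih]

/-- Membership in `ℤ_β` can be tested at any scale `β ^ N` exceeding `|x|`. -/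
theorem mem_betaInt_iff {β x : ℝ} (hβ : 1 < β) {N : ℕ}
    (h : |x| / β ^ N ∈ Set.Ico (0 : ℝ) 1) :
    x ∈ betaInt β ↔ (betaT β)^[N] (|x| / β ^ N) = 0 := by
  refine ⟨?_, fun h0 => ⟨N, h, h0⟩⟩
  rintro ⟨M, hM, h0⟩
  rw [← iterate_betaT_div_pow_add hβ h M, add_comm, iterate_betaT_div_pow_add hβ hM N, h0]

theorem abs_pow_mul_div_pow_add {β : ℝ} (hβ : 1 < β) (x : ℝ) (N k : ℕ) :
    |β ^ k * x| / β ^ (N + k) = |x| / β ^ N := by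
  have h0 : 0 < β ^ k := by positivity
  rw [abs_mul, abs_of_pos h0, pow_add, mul_comm (β ^ N), mul_div_mul_left _ _ h0.ne']

theorem pow_mul_mem_betaInt {β x : ℝ} (hβ : 1 < β) (hx : x ∈ betaInt β) (k : ℕ) :
    β ^ k * x ∈ betaInt β := by
  obtain ⟨N, hN, h0⟩ := hx
  refine ⟨N + k, ?_, ?_⟩
  · rwa [abs_pow_mul_div_pow_add hβ]
  · rw [abs_pow_mul_div_pow_add hβ, add_comm, Function.iterate_add_apply, h0, iterate_betaT_zero]

theorem exists_pow_mul_mem_betaInt {β x : ℝ} (hβ : 1 < β) (hx : x ∈ finBeta β) :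
    ∃ k : ℕ, β ^ k * x ∈ betaInt β := by
  obtain ⟨N, n, hN, h0⟩ := hx
  refine ⟨n, N + n, ?_, ?_⟩
  · rwa [abs_pow_mul_div_pow_add hβ]
  · rw [abs_pow_mul_div_pow_add hβ, Function.iterate_add_apply, h0, iterate_betaT_zero]

theorem betaT_inv_pow_succ {β : ℝ} (hβ : 1 < β) {m : ℕ} (hm : 1 ≤ m) :
    betaT β ((β ^ (m + 1))⁻¹) = (β ^ m)⁻¹ := by
  have := betaT_div_pow_succ (x := 1) hβ (N := m)
    ⟨by positivity, by simpa using inv_lt_one_of_one_lt₀ (one_lt_pow₀ hβ (by omega))⟩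
  simpa using this

theorem iterate_betaT_inv_pow_add {β : ℝ} (hβ : 1 < β) {m : ℕ} (hm : 1 ≤ m) (k : ℕ) :
    (betaT β)^[k] ((β ^ (m + k))⁻¹) = (β ^ m)⁻¹ := by
  induction k with
  | zero => rfl
  | succ k ih =>
    rw [Function.iterate_succ_apply, ← add_assoc, betaT_inv_pow_succ hβ (by omega), ih]

theorem betaT_inv {β : ℝ} (hβ : 1 < β) : betaT β β⁻¹ = 0 := by
  have h : β * β⁻¹ = 1 := mul_inv_cancel₀ (by linarith)
  simp [betaT, h]

theorem pow_add_inv_pow_div_mem_Ico {β : ℝ} (hβ : 2 ≤ β) {k m : ℕ} (hm : 1 ≤ m) :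
    |β ^ k + (β ^ m)⁻¹| / β ^ (k + 1) ∈ Set.Ico (0 : ℝ) 1 := by
  have h1 : (β ^ m)⁻¹ < 1 := inv_lt_one_of_one_lt₀ (one_lt_pow₀ (by linarith) (by omega))
  have h2 : 1 ≤ β ^ k := one_le_pow₀ (by linarith)
  have h3 : 0 < (β ^ m)⁻¹ := by positivity
  refine ⟨by positivity, ?_⟩
  rw [abs_of_pos (by linarith), div_lt_one (by positivity), pow_succ]
  nlinarith

theorem iterate_betaT_pow_add_inv_pow {β : ℝ} (hβ : 2 ≤ β) {k m : ℕ} (hm : 1 ≤ m) :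
    (betaT β)^[k + 1] (|β ^ k + (β ^ m)⁻¹| / β ^ (k + 1)) = (β ^ m)⁻¹ := by
  have h0 : 0 < β := by linarith
  have hpos : 0 < (β ^ (m + k))⁻¹ := by positivity
  have hlt : (β ^ (m + k))⁻¹ < 1 :=
    inv_lt_one_of_one_lt₀ (one_lt_pow₀ (by linarith) (by omega))
  have he : β * (|β ^ k + (β ^ m)⁻¹| / β ^ (k + 1)) = 1 + (β ^ (m + k))⁻¹ := by
    rw [abs_of_pos (by positivity)]
    field_simp
    ring
  rw [Function.iterate_succ_apply,
    betaT_eq_of_mem_Ico 1 (by rw [he]; push_cast; constructor <;> linarith), he]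
  simpa using iterate_betaT_inv_pow_add (by linarith) hm k

theorem pow_add_inv_pow_mem_finBeta {β : ℝ} (hβ : 2 ≤ β) {k m : ℕ} (hm : 1 ≤ m) :
    β ^ k + (β ^ m)⁻¹ ∈ finBeta β := by
  refine ⟨k + 1, m + (k + 1), pow_add_inv_pow_div_mem_Ico hβ hm, ?_⟩
  rw [Function.iterate_add_apply, iterate_betaT_pow_add_inv_pow hβ hm]
  obtain ⟨n, rfl⟩ : ∃ n, m = n + 1 := ⟨m - 1, by omega⟩
  have h1 : 1 < β := by linarith
  have := iterate_betaT_inv_pow_add h1 le_rfl n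
  rw [add_comm 1 n, pow_one] at this
  rw [Function.iterate_succ_apply', this, betaT_inv h1]

theorem pow_add_inv_pow_notMem_betaInt {β : ℝ} (hβ : 2 ≤ β) {k m : ℕ}
    (hm : 1 ≤ m) : β ^ k + (β ^ m)⁻¹ ∉ betaInt β := by
  rw [mem_betaInt_iff (by linarith) (pow_add_inv_pow_div_mem_Ico hβ hm),
    iterate_betaT_pow_add_inv_pow hβ hm]
  positivity

theorem intCast_mem_betaInt {β : ℝ} (hβ : 1 < β) {c : ℤ} (hc : 0 ≤ c) (hcβ : (c : ℝ) < β) :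
    (c : ℝ) ∈ betaInt β := by
  have hc' : (0 : ℝ) ≤ c := by exact_mod_cast hc
  have h : β * (c / β) = c := mul_div_cancel₀ _ (by linarith)
  refine ⟨1, ⟨by positivity, ?_⟩, ?_⟩
  · rwa [abs_of_nonneg hc', pow_one, div_lt_one (by linarith)]
  · rw [abs_of_nonneg hc', pow_one, Function.iterate_one]
    simp [betaT, h]

theorem add_one_mem_betaInt {β : ℝ} (hβ : 2 ≤ β) : β + 1 ∈ betaInt β := by
  have h0 : 0 < β := by linarith
  have hi : β⁻¹ < 1 := inv_lt_one_of_one_lt₀ (by linarith)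
  have hi0 : 0 < β⁻¹ := by positivity
  have he : β * (|β + 1| / β ^ 2) = 1 + β⁻¹ := by
    rw [abs_of_pos (by positivity)]
    field_simp
  refine ⟨2, ⟨by positivity, ?_⟩, ?_⟩
  · rw [abs_of_pos (by positivity), div_lt_one (by positivity)]
    nlinarith
  · have hT : betaT β (|β + 1| / β ^ 2) = β⁻¹ := by
      rw [betaT_eq_of_mem_Ico 1 (by rw [he]; push_cast; constructor <;> linarith), he]
      simp
    rw [Function.iterate_succ_apply, Function.iterate_one, hT, betaT_inv (by linarith)]

/-- The dominant root of `X ^ 3 - a X ^ 2 - b X + 1` has integer part `a`. -/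
theorem cubic_root_bounds {a b : ℤ} (hb : 0 < b) (hba : b < a) {β : ℝ} (hβ : 1 < β)
    (hroot : β ^ 3 - (a : ℝ) * β ^ 2 - (b : ℝ) * β + 1 = 0) :
    (a : ℝ) < β ∧ β < a + 1 := by
  have hb' : (1 : ℝ) ≤ b := by exact_mod_cast hb
  have hba' : (b : ℝ) + 1 ≤ a := by exact_mod_cast hba
  have h1 : (a : ℝ) < β := by
    by_contra! h
    nlinarith [mul_nonneg (sq_nonneg β) (sub_nonneg.2 h)]
  refine ⟨h1, ?_⟩
  by_contra! h
  nlinarith [mul_nonneg (sq_nonneg β) (sub_nonneg.2 h)]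

/-- The conjugate of the integer formed by the first `j` digits of `t` is bounded; after a maximal
digit `a` the bound is larger by one, but the remainder is then less than `β - a`. -/
theorem exists_conj_prefix {a b : ℤ} (hb : 0 < b) (hba : b < a) {β α : ℝ} (hβ : 1 < β)
    (hroot : β ^ 3 - (a : ℝ) * β ^ 2 - (b : ℝ) * β + 1 = 0) (hα0 : 0 < α) (hα1 : α < 1)
    {t : ℝ} (ht : t ∈ Set.Ico (0 : ℝ) 1) (j : ℕ) :
    ∃ q : ℤ[X], aeval β q = β ^ j * t - (betaT β)^[j] t ∧ 0 ≤ aeval α q ∧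
      (aeval α q ≤ (a - 1) / (1 - α) ∨
        aeval α q ≤ (a - 1) / (1 - α) + 1 ∧ (betaT β)^[j] t < β - a) := by
  obtain ⟨haβ, hβa⟩ := cubic_root_bounds hb hba hβ hroot
  have hb' : (1 : ℝ) ≤ b := by exact_mod_cast hb
  have hba' : (b : ℝ) + 1 ≤ a := by exact_mod_cast hba
  set M : ℝ := (a - 1) / (1 - α) with hM
  have hMα : α * M = M - (a - 1) := by
    have : M * (1 - α) = a - 1 := div_mul_cancel₀ _ (by linarith)
    linarith
  have hM0 : 0 ≤ M := div_nonneg (by linarith) (by linarith)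
  induction j with
  | zero => exact ⟨0, by simp, by simp, Or.inl (by simpa using hM0)⟩
  | succ j ih =>
    obtain ⟨q, hq, hq0, hqM⟩ := ih
    set s := (betaT β)^[j] t with hs
    have hsI : s ∈ Set.Ico (0 : ℝ) 1 := iterate_betaT_mem_Ico β ht j
    set d : ℤ := ⌊β * s⌋ with hd
    have hT : (betaT β)^[j + 1] t = β * s - d := by
      rw [Function.iterate_succ_apply', ← hs]; rfl
    have hd0 : 0 ≤ d := Int.floor_nonneg.2 (mul_nonneg (by linarith) hsI.1)
    have hd0' : (0 : ℝ) ≤ d := by exact_mod_cast hd0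
    have hdle : (d : ℝ) ≤ β * s := Int.floor_le _
    have hsβ : β * s < β := by nlinarith [hsI.2]
    have hda : d ≤ a := by
      have : (d : ℝ) < (a + 1 : ℤ) := by push_cast; linarith
      have := Int.cast_lt.1 this
      omega
    have hev : aeval α (X * q + C d) = α * aeval α q + d := by simp
    refine ⟨X * q + C d, ?_, ?_, ?_⟩
    · rw [hT, map_add, map_mul, hq]
      simp
      ring
    · rw [hev]; positivity
    · rw [hev, hT]
      rcases hqM with h | ⟨h, hlt⟩
      · have h1 := mul_le_mul_of_nonneg_left h hα0.le
        rcases eq_or_lt_of_le hda with rfl | hlt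
        · exact Or.inr ⟨by linarith, by linarith⟩
        · have : (d : ℝ) + 1 ≤ a := by exact_mod_cast hlt
          exact Or.inl (by linarith)
      · have h1 := mul_le_mul_of_nonneg_left h hα0.le
        have h2 : β * (β - a) < b := by
          by_contra! h2
          nlinarith
        have h3 : (d : ℝ) < b := by nlinarith
        have h4 : (d : ℝ) + 1 ≤ b := by exact_mod_cast (Int.cast_lt.1 h3)
        exact Or.inl (by linarith)

theorem exists_conj_of_mem_betaInt {a b : ℤ} (hb : 0 < b) (hba : b < a) {β α : ℝ} (hβ : 1 < β)
    (hroot : β ^ 3 - (a : ℝ) * β ^ 2 - (b : ℝ) * β + 1 = 0) (hα0 : 0 < α) (hα1 : α < 1)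
    {x : ℝ} (hx : x ∈ betaInt β) :
    ∃ q : ℤ[X], aeval β q = x ∧ |aeval α q| ≤ (a - 1) / (1 - α) + 1 := by
  obtain ⟨N, hN, h0⟩ := hx
  obtain ⟨q, hq, hq0, hqM⟩ := exists_conj_prefix hb hba hβ hroot hα0 hα1 hN N
  have hqx : aeval β q = |x| := by
    rw [hq, h0, sub_zero, mul_div_cancel₀ _ (by positivity)]
  have hqa : |aeval α q| ≤ (a - 1) / (1 - α) + 1 := by
    rw [abs_of_nonneg hq0]
    rcases hqM with h | h <;> linarith
  rcases abs_choice x with h | h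
  · exact ⟨q, by rw [hqx, h], hqa⟩
  · exact ⟨-q, by rw [map_neg, hqx, h, neg_neg], by rwa [map_neg, abs_neg]⟩

/-- A `β`-integer not divisible by `β` within `ℤ_β` has a conjugate of size at least one. -/
theorem exists_one_le_conj_of_mul_mem_betaInt {a b : ℤ} (hb : 0 < b) (hba : b < a) {β α : ℝ}
    (hβ : 1 < β) (hroot : β ^ 3 - (a : ℝ) * β ^ 2 - (b : ℝ) * β + 1 = 0) (hα0 : 0 < α)
    (hα1 : α < 1) {x : ℝ} (hx : β * x ∈ betaInt β) (hx' : x ∉ betaInt β) :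
    ∃ q : ℤ[X], aeval β q = β * x ∧ 1 ≤ |aeval α q| := by
  obtain ⟨N, hN, h0⟩ := hx
  have hN' : |β * x| / β ^ (N + 1) ∈ Set.Ico (0 : ℝ) 1 := div_pow_add_mem_Ico hβ hN 1
  have h0' : (betaT β)^[N + 1] (|β * x| / β ^ (N + 1)) = 0 := by
    rw [iterate_betaT_div_pow_add hβ hN 1, h0]
  have hscale : |β * x| / β ^ (N + 1) = |x| / β ^ N := by
    simpa using abs_pow_mul_div_pow_add hβ x N 1
  rw [hscale] at hN' h0'
  obtain ⟨q, hq, hq0, -⟩ := exists_conj_prefix hb hba hβ hroot hα0 hα1 hN' N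
  set s := (betaT β)^[N] (|x| / β ^ N) with hs
  have hs0 : s ≠ 0 := fun h => hx' ⟨N, hN', h⟩
  have hspos : 0 < s := lt_of_le_of_ne (iterate_betaT_mem_Ico β hN' N).1 hs0.symm
  rw [Function.iterate_succ_apply', ← hs] at h0'
  set d : ℤ := ⌊β * s⌋ with hd
  have hds : β * s = d := sub_eq_zero.1 h0'
  have hd1 : (1 : ℝ) ≤ d := by
    have : (0 : ℝ) < d := by rw [← hds]; positivity
    exact_mod_cast (Int.cast_pos.1 this)
  rw [mul_div_cancel₀ _ (by positivity)] at hq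
  have hr : aeval β (X * q + C d) = β * |x| := by
    rw [map_add, map_mul, hq]
    simp
    linarith
  have hr1 : 1 ≤ |aeval α (X * q + C d)| := by
    refine le_trans ?_ (le_abs_self _)
    have : aeval α (X * q + C d) = α * aeval α q + d := by simp
    rw [this]
    nlinarith [mul_nonneg hα0.le hq0]
  rcases abs_choice x with h | h
  · exact ⟨_, by rw [hr, h], hr1⟩
  · exact ⟨-(X * q + C d), by rw [map_neg, hr, h]; ring, by rwa [map_neg, abs_neg]⟩

theorem pow_mul_add_mem_betaInt {a b : ℤ} (hb : 0 < b) (hba : b < a) {β α : ℝ} (hβ : 1 < β)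
    (hroot : β ^ 3 - (a : ℝ) * β ^ 2 - (b : ℝ) * β + 1 = 0) (hα0 : 0 < α) (hα1 : α < 1)
    (hα : α ^ 3 - (a : ℝ) * α ^ 2 - (b : ℝ) * α + 1 = 0) {L : ℕ}
    (hL : α ^ (L + 1) * (2 * (a - α)) < 1 - α) {x y : ℝ} (hx : x ∈ betaInt β)
    (hy : y ∈ betaInt β) (hxy : x + y ∈ finBeta β) : β ^ L * (x + y) ∈ betaInt β := by
  classical
  have hex := exists_pow_mul_mem_betaInt hβ hxy
  set k := Nat.find hex with hk
  have hkmem : β ^ k * (x + y) ∈ betaInt β := Nat.find_spec hex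
  rcases le_or_gt k L with hkL | hkL
  · have := pow_mul_mem_betaInt hβ hkmem (L - k)
    rwa [← mul_assoc, ← pow_add, Nat.sub_add_cancel hkL] at this
  exfalso
  obtain ⟨n, hn⟩ : ∃ n, k = n + 1 := ⟨k - 1, by omega⟩
  have hnmem : β ^ n * (x + y) ∉ betaInt β := Nat.find_min hex (by omega)
  have hmul : β * (β ^ n * (x + y)) = β ^ k * (x + y) := by rw [hn]; ring
  rw [← hmul] at hkmem
  obtain ⟨p, hp, hp1⟩ :=
    exists_one_le_conj_of_mul_mem_betaInt hb hba hβ hroot hα0 hα1 hkmem hnmem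
  obtain ⟨q, hq, hqM⟩ := exists_conj_of_mem_betaInt hb hba hβ hroot hα0 hα1 hx
  obtain ⟨r, hr, hrM⟩ := exists_conj_of_mem_betaInt hb hba hβ hroot hα0 hα1 hy
  have hconj : aeval α (p - X ^ k * (q + r)) = 0 :=
    aeval_eq_zero_of_aeval_eq_zero a b hb hba hroot hα (by simp [hp, hq, hr, hmul])
  have hpα : aeval α p = α ^ k * (aeval α q + aeval α r) := by
    simpa [sub_eq_zero] using hconj
  have hM : (a - 1 : ℝ) / (1 - α) + 1 = (a - α) / (1 - α) := by
    have : 1 - α ≠ 0 := by linarith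
    field_simp
    ring
  rw [hM] at hqM hrM
  have hαk : α ^ k ≤ α ^ (L + 1) := pow_le_pow_of_le_one hα0.le hα1.le hkL
  have hsum : |aeval α q + aeval α r| ≤ 2 * ((a - α) / (1 - α)) :=
    (abs_add_le _ _).trans (by linarith)
  have : |aeval α p| ≤ α ^ (L + 1) * (2 * ((a - α) / (1 - α))) := by
    rw [hpα, abs_mul, abs_of_pos (by positivity)]
    exact mul_le_mul hαk hsum (abs_nonneg _) (by positivity)
  have hlt : α ^ (L + 1) * (2 * ((a - α) / (1 - α))) < 1 := by
    rw [← mul_div_assoc, ← mul_div_assoc, div_lt_one (by linarith)]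
    exact hL
  linarith

theorem exists_cubic_root_between {a b : ℤ} {u v : ℝ} (huv : u ≤ v)
    (hu : 0 < u ^ 3 - (a : ℝ) * u ^ 2 - (b : ℝ) * u + 1)
    (hv : v ^ 3 - (a : ℝ) * v ^ 2 - (b : ℝ) * v + 1 < 0) :
    ∃ α : ℝ, u < α ∧ α < v ∧ α ^ 3 - (a : ℝ) * α ^ 2 - (b : ℝ) * α + 1 = 0 := by
  have hc : ContinuousOn (fun x : ℝ => x ^ 3 - (a : ℝ) * x ^ 2 - (b : ℝ) * x + 1)
      (Set.Icc u v) := by fun_prop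
  obtain ⟨α, hα, h⟩ := intermediate_value_Ioo' huv hc ⟨hv, hu⟩
  exact ⟨α, hα.1, hα.2, h⟩

theorem exists_conjugate_of_ne {a b : ℤ} (hb : 0 < b) (hba : b < a) (hab : ¬ (a = 2 ∧ b = 1)) :
    ∃ α : ℝ, 0 < α ∧ α < 1 ∧ α ^ 3 - (a : ℝ) * α ^ 2 - (b : ℝ) * α + 1 = 0 ∧
      α ^ (2 + 1) * (2 * (a - α)) < 1 - α := by
  have hb' : (1 : ℝ) ≤ b := by exact_mod_cast hb
  have hba' : (b : ℝ) + 1 ≤ a := by exact_mod_cast hba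
  suffices h : ∃ α : ℝ, 0 < α ∧ α < 1 ∧ α ^ 3 - (a : ℝ) * α ^ 2 - (b : ℝ) * α + 1 = 0 ∧
      3 * α - 2 * b * α ^ 2 < 1 by
    obtain ⟨α, h0, h1, hα, hlt⟩ := h
    refine ⟨α, h0, h1, hα, ?_⟩
    have : α ^ (2 + 1) * (2 * (a - α)) = 2 * α - 2 * b * α ^ 2 := by
      linear_combination (-2 * α) * hα
    linarith
  rcases eq_or_lt_of_le (show 1 ≤ b from hb) with rfl | hb2
  · have ha : (3 : ℝ) ≤ a := by
      have : 3 ≤ a := by omega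
      exact_mod_cast this
    obtain ⟨α, h0, h1, hα⟩ := exists_cubic_root_between (a := a) (b := 1) (u := 0) (v := 1 / 2)
      (by norm_num) (by norm_num) (by norm_num; linarith)
    refine ⟨α, h0, by linarith, hα, ?_⟩
    push_cast
    nlinarith [mul_pos (show 0 < 1 - α by linarith) (show 0 < 1 - 2 * α by linarith)]
  · have hb3 : (2 : ℝ) ≤ b := by exact_mod_cast hb2
    obtain ⟨α, h0, h1, hα⟩ := exists_cubic_root_between (a := a) (b := b) (u := 0) (v := 1)
      (by norm_num) (by norm_num) (by norm_num; linarith)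
    refine ⟨α, h0, h1, hα, ?_⟩
    nlinarith [mul_nonneg (sub_nonneg.2 hb3) (sq_nonneg α), sq_nonneg (8 * α - 3)]

theorem exists_conjugate_two_one :
    ∃ α : ℝ, 0 < α ∧ α < 1 ∧ α ^ 3 - ((2 : ℤ) : ℝ) * α ^ 2 - ((1 : ℤ) : ℝ) * α + 1 = 0 ∧
      α ^ (3 + 1) * (2 * (((2 : ℤ) : ℝ) - α)) < 1 - α := by
  obtain ⟨α, h0, h1, hα⟩ := exists_cubic_root_between (a := 2) (b := 1) (u := 0) (v := 56 / 100)
    (by norm_num) (by norm_num) (by norm_num)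
  refine ⟨α, h0, by linarith, hα, ?_⟩
  push_cast at hα ⊢
  have h2 : α ^ 2 ≤ (56 / 100) ^ 2 := by gcongr
  have : α ^ (3 + 1) * (2 * (2 - α)) = 2 * α ^ 2 - 2 * α ^ 3 := by
    linear_combination (-2 * α ^ 2) * hα
  rw [this]
  nlinarith [mul_nonneg (sq_nonneg α) h0.le]

theorem Lplus_le {β : ℝ} {L : ℕ} (h : ∀ x ∈ betaInt β, ∀ y ∈ betaInt β,
    x + y ∈ finBeta β → β ^ L * (x + y) ∈ betaInt β) : Lplus β ≤ L := Nat.sInf_le h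

theorem Lplus_spec {β : ℝ} {L : ℕ} (h : ∀ x ∈ betaInt β, ∀ y ∈ betaInt β,
    x + y ∈ finBeta β → β ^ L * (x + y) ∈ betaInt β) : ∀ x ∈ betaInt β, ∀ y ∈ betaInt β,
    x + y ∈ finBeta β → β ^ Lplus β * (x + y) ∈ betaInt β :=
  Nat.sInf_mem (s := {L : ℕ | ∀ x ∈ betaInt β, ∀ y ∈ betaInt β,
    x + y ∈ finBeta β → β ^ L * (x + y) ∈ betaInt β}) ⟨L, h⟩

theorem stmt8 (a b : ℤ) (hb : 0 < b) (hba : b < a) (β : ℝ) (hβ : 1 < β)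
    (hroot : β ^ 3 - (a : ℝ) * β ^ 2 - (b : ℝ) * β + 1 = 0) :
    (¬ (a = 2 ∧ b = 1) → 1 ≤ Lplus β ∧ Lplus β ≤ 2) ∧
    ((a = 2 ∧ b = 1) → 2 ≤ Lplus β ∧ Lplus β ≤ 3) := by
  obtain ⟨haβ, -⟩ := cubic_root_bounds hb hba hβ hroot
  have hb' : (1 : ℝ) ≤ b := by exact_mod_cast hb
  have hba' : (b : ℝ) + 1 ≤ a := by exact_mod_cast hba
  have hβ2 : 2 ≤ β := by linarith
  have hβ0 : β ≠ 0 := by linarith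
  constructor
  · intro hab
    obtain ⟨α, hα0, hα1, hα, hL⟩ := exists_conjugate_of_ne hb hba hab
    have hset : ∀ x ∈ betaInt β, ∀ y ∈ betaInt β,
        x + y ∈ finBeta β → β ^ 2 * (x + y) ∈ betaInt β := fun x hx y hy hxy =>
      pow_mul_add_mem_betaInt hb hba hβ hroot hα0 hα1 hα hL hx hy hxy
    refine ⟨?_, Lplus_le hset⟩
    by_contra! hlt
    have hspec := Lplus_spec hset
    have he : β ^ 1 * (a : ℝ) + b = β ^ 2 + (β ^ 1)⁻¹ := by
      field_simp
      linear_combination -hroot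
    have hx : β ^ 1 * (a : ℝ) ∈ betaInt β :=
      pow_mul_mem_betaInt hβ (intCast_mem_betaInt hβ (by omega) haβ) 1
    have hy : (b : ℝ) ∈ betaInt β := intCast_mem_betaInt hβ hb.le (by linarith)
    have := hspec _ hx _ hy (he ▸ pow_add_inv_pow_mem_finBeta hβ2 le_rfl)
    rw [show Lplus β = 0 by omega, pow_zero, one_mul, he] at this
    exact pow_add_inv_pow_notMem_betaInt hβ2 le_rfl this
  · rintro ⟨rfl, rfl⟩
    obtain ⟨α, hα0, hα1, hα, hL⟩ := exists_conjugate_two_one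
    have hset : ∀ x ∈ betaInt β, ∀ y ∈ betaInt β,
        x + y ∈ finBeta β → β ^ 3 * (x + y) ∈ betaInt β := fun x hx y hy hxy =>
      pow_mul_add_mem_betaInt hb hba hβ hroot hα0 hα1 hα hL hx hy hxy
    refine ⟨?_, Lplus_le hset⟩
    by_contra! hlt
    have hspec := Lplus_spec hset
    push_cast at hroot
    have he : β + 1 + ((2 : ℤ) : ℝ) = β ^ 2 + (β ^ 2)⁻¹ := by
      push_cast
      field_simp
      linear_combination (-β - 1) * hroot
    have hx : β + 1 ∈ betaInt β := add_one_mem_betaInt hβ2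
    have hy : ((2 : ℤ) : ℝ) ∈ betaInt β := intCast_mem_betaInt hβ (by norm_num) haβ
    have hz := hspec _ hx _ hy
      (he ▸ pow_add_inv_pow_mem_finBeta hβ2 (by norm_num))
    rw [he] at hz
    interval_cases hl : Lplus β
    · rw [pow_zero, one_mul] at hz
      exact pow_add_inv_pow_notMem_betaInt hβ2 (by norm_num) hz
    · have h3 : β ^ 1 * (β ^ 2 + (β ^ 2)⁻¹) = β ^ 3 + (β ^ 1)⁻¹ := by
        field_simp
      rw [h3] at hz
      exact pow_add_inv_pow_notMem_betaInt hβ2 le_rfl hz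
end

section
/- Let a, b be integers with 0 < b < a and let β be the unique real root greater than 1 of the polynomial P(X) = X^3 − aX^2 − bX + 1. If either (a ≥ 3 and b = 1) or (a ≥ 4 and b = 2), then L_⊕(β) = 2. -/
open Polynomial

namespace BetaExpansion

lemma betaT_of_digit {β : ℝ} (hβ : 1 < β) (d : ℤ) {t : ℝ} (h0 : 0 ≤ t) (h1 : t < 1) :
    betaT β ((d + t) / β) = t := by
  have h : β * ((d + t) / β) = d + t := by field_simp
  have hf : ⌊t⌋ = 0 := Int.floor_eq_zero_iff.2 ⟨h0, h1⟩
  simp [betaT, h, hf]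

lemma betaT_zero (β : ℝ) : betaT β 0 = 0 := by simp [betaT]

lemma betaT_mem_Ico (β x : ℝ) : betaT β x ∈ Set.Ico (0 : ℝ) 1 :=
  ⟨Int.fract_nonneg _, Int.fract_lt_one _⟩

lemma betaT_iterate_mem_Ico (β : ℝ) {x : ℝ} (hx : x ∈ Set.Ico (0 : ℝ) 1) (n : ℕ) :
    (betaT β)^[n] x ∈ Set.Ico (0 : ℝ) 1 := by
  cases n with
  | zero => exact hx
  | succ n => rw [Function.iterate_succ_apply']; exact betaT_mem_Ico _ _

lemma betaT_iterate_zero (β : ℝ) (n : ℕ) : (betaT β)^[n] 0 = 0 := by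
  induction n with
  | zero => rfl
  | succ n ih => rw [Function.iterate_succ_apply', ih, betaT_zero]

lemma betaT_iterate_eq_zero_of_le {β x : ℝ} {m n : ℕ} (hmn : m ≤ n)
    (h : (betaT β)^[m] x = 0) : (betaT β)^[n] x = 0 := by
  obtain ⟨k, rfl⟩ := Nat.exists_eq_add_of_le' hmn
  rw [Function.iterate_add_apply, h, betaT_iterate_zero]

lemma betaT_iterate_div_pow {β : ℝ} (hβ : 1 < β) {t : ℝ} (ht : t ∈ Set.Ico (0 : ℝ) 1) (k : ℕ) :
    (betaT β)^[k] (t / β ^ k) = t := by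
  have hβ0 : 0 < β := by linarith
  induction k with
  | zero => simp
  | succ k ih =>
    have h1 : t / β ^ k < 1 :=
      (div_lt_one (by positivity)).2 (ht.2.trans_le (one_le_pow₀ hβ.le))
    have h := betaT_of_digit hβ 0 (div_nonneg ht.1 (pow_nonneg hβ0.le k)) h1
    rw [Function.iterate_succ_apply, pow_succ, ← div_div]
    simpa [ih] using congrArg (betaT β)^[k] h

lemma betaT_iterate_shift {β : ℝ} (hβ : 1 < β) {v : ℝ} {n : ℕ}
    (hv : v / β ^ n ∈ Set.Ico (0 : ℝ) 1) (k : ℕ) :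
    (betaT β)^[n + k] (v / β ^ (n + k)) = (betaT β)^[n] (v / β ^ n) := by
  rw [Function.iterate_add_apply, pow_add, ← div_div, betaT_iterate_div_pow hβ hv]

/-- `v` is a nonnegative `β`-integer with at most `n` digits. -/
def HasDigits (β : ℝ) (n : ℕ) (v : ℝ) : Prop :=
  v / β ^ n ∈ Set.Ico (0 : ℝ) 1 ∧ (betaT β)^[n] (v / β ^ n) = 0

lemma hasDigits_zero (β : ℝ) : HasDigits β 0 0 := by simp [HasDigits]

lemma HasDigits.cons {β : ℝ} (hβ : 1 < β) {n : ℕ} {v : ℝ} (h : HasDigits β n v) {d : ℤ}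
    (hd : 0 ≤ d) (hlt : d * β ^ n + v < β ^ (n + 1)) : HasDigits β (n + 1) (d * β ^ n + v) := by
  have hβ0 : 0 < β := by linarith
  have he : (d * β ^ n + v) / β ^ (n + 1) = (d + v / β ^ n) / β := by
    rw [pow_succ]; field_simp
  have hd' : (0 : ℝ) ≤ d := by exact_mod_cast hd
  refine ⟨⟨?_, (div_lt_one (by positivity)).2 hlt⟩, ?_⟩
  · rw [he]; exact div_nonneg (add_nonneg hd' h.1.1) hβ0.le
  · rw [he, Function.iterate_succ_apply, betaT_of_digit hβ d h.1.1 h.1.2, h.2]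

lemma HasDigits.mem_betaInt {β : ℝ} (hβ : 1 < β) {n : ℕ} {v : ℝ} (h : HasDigits β n v) :
    v ∈ betaInt β := by
  have hv : 0 ≤ v := by
    have := mul_nonneg h.1.1 (pow_nonneg (by linarith : 0 ≤ β) n)
    rwa [div_mul_cancel₀ _ (by positivity)] at this
  exact ⟨n, by simpa [HasDigits, abs_of_nonneg hv] using h⟩

lemma mul_mem_betaInt {β : ℝ} (hβ : 1 < β) {z : ℝ} (hz : z ∈ betaInt β) :
    β * z ∈ betaInt β := by
  obtain ⟨N, h1, h2⟩ := hz
  have hβ0 : 0 < β := by linarith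
  have he : |β * z| / β ^ (N + 1) = |z| / β ^ N := by
    rw [abs_mul, abs_of_pos hβ0, pow_succ']; field_simp
  exact ⟨N + 1, by rwa [he], by rw [he]; exact betaT_iterate_eq_zero_of_le (Nat.le_succ N) h2⟩

lemma pow_add_inv_sq_mem_finBeta {β : ℝ} (hβ : 2 ≤ β) (m : ℕ) :
    β ^ m + (β ^ 2)⁻¹ ∈ finBeta β := by
  have hβ1 : 1 < β := by linarith
  have hβ0 : 0 < β := by linarith
  have hpos : 0 < β ^ m + (β ^ 2)⁻¹ := by positivity
  have he : (β ^ m + (β ^ 2)⁻¹) / β ^ (m + 1) = (((1 : ℤ) : ℝ) + β⁻¹ / β ^ (m + 1)) / β := by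
    push_cast; field_simp; ring
  have hi : β⁻¹ ∈ Set.Ico (0 : ℝ) 1 := ⟨by positivity, inv_lt_one_of_one_lt₀ hβ1⟩
  have hsmall : β⁻¹ / β ^ (m + 1) < 1 :=
    (div_lt_one (by positivity)).2 (hi.2.trans_le (one_le_pow₀ hβ1.le))
  refine ⟨m + 1, m + 3, ?_, ?_⟩ <;> rw [abs_of_pos hpos]
  · refine ⟨by positivity, ?_⟩
    rw [he, div_lt_one hβ0]; push_cast; linarith
  · rw [he, Function.iterate_succ_apply, betaT_of_digit hβ1 1 (by positivity) hsmall,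
      Function.iterate_succ_apply', betaT_iterate_div_pow hβ1 hi]
    have := betaT_of_digit hβ1 1 (le_refl (0 : ℝ)) one_pos
    simpa using this

lemma mul_pow_add_inv_sq_notMem_betaInt {β : ℝ} (hβ : 2 ≤ β) (m : ℕ) :
    β * (β ^ m + (β ^ 2)⁻¹) ∉ betaInt β := by
  have hβ1 : 1 < β := by linarith
  have hβ0 : 0 < β := by linarith
  have hpos : 0 < β * (β ^ m + (β ^ 2)⁻¹) := by positivity
  have he : β * (β ^ m + (β ^ 2)⁻¹) / β ^ (m + 2) =
      (((1 : ℤ) : ℝ) + β⁻¹ / β ^ (m + 1)) / β := by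
    push_cast; field_simp; ring
  have hi : β⁻¹ ∈ Set.Ico (0 : ℝ) 1 := ⟨by positivity, inv_lt_one_of_one_lt₀ hβ1⟩
  have hsmall : β⁻¹ / β ^ (m + 1) < 1 :=
    (div_lt_one (by positivity)).2 (hi.2.trans_le (one_le_pow₀ hβ1.le))
  have hmem : β * (β ^ m + (β ^ 2)⁻¹) / β ^ (m + 2) ∈ Set.Ico (0 : ℝ) 1 := by
    refine ⟨by positivity, ?_⟩
    rw [he, div_lt_one hβ0]; push_cast; linarith
  have hval : (betaT β)^[m + 2] (β * (β ^ m + (β ^ 2)⁻¹) / β ^ (m + 2)) = β⁻¹ := by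
    rw [he, Function.iterate_succ_apply, betaT_of_digit hβ1 1 (by positivity) hsmall,
      betaT_iterate_div_pow hβ1 hi]
  have hne : β⁻¹ ≠ 0 := by positivity
  rintro ⟨N, h1, h2⟩
  rw [abs_of_pos hpos] at h1 h2
  rcases le_total N (m + 2) with h | h
  · obtain ⟨k, hk⟩ := Nat.exists_eq_add_of_le h
    have := betaT_iterate_shift hβ1 h1 k
    rw [← hk, hval, h2] at this
    exact hne this
  · obtain ⟨k, rfl⟩ := Nat.exists_eq_add_of_le h
    have := betaT_iterate_shift hβ1 hmem k
    rw [h2, hval] at this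
    exact hne this.symm

/-- The integer polynomial whose coefficients are the first `n` digits of the greedy
expansion of `w`. -/
noncomputable def digitPoly (β w : ℝ) : ℕ → ℤ[X]
  | 0 => 0
  | n + 1 => X * digitPoly β w n + C ⌊β * (betaT β)^[n] w⌋

lemma pow_mul_eq_aeval_digitPoly (β w : ℝ) (n : ℕ) :
    β ^ n * w = aeval β (digitPoly β w n) + (betaT β)^[n] w := by
  induction n with
  | zero => simp [digitPoly]
  | succ n ih =>
    have h : (betaT β)^[n + 1] w = β * (betaT β)^[n] w - ⌊β * (betaT β)^[n] w⌋ := by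
      rw [Function.iterate_succ_apply']; rfl
    rw [h, digitPoly, pow_succ', mul_assoc, ih]
    simp only [map_add, map_mul, map_intCast, aeval_X, eq_intCast]
    ring

lemma aeval_digitPoly_nonneg {β w γ : ℝ} (hβ : 0 ≤ β) (hw : w ∈ Set.Ico (0 : ℝ) 1)
    (hγ : 0 ≤ γ) (n : ℕ) : 0 ≤ aeval γ (digitPoly β w n) := by
  induction n with
  | zero => simp [digitPoly]
  | succ n ih =>
    have : 0 ≤ ⌊β * (betaT β)^[n] w⌋ :=
      Int.floor_nonneg.2 (mul_nonneg hβ (betaT_iterate_mem_Ico β hw n).1)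
    have : (0 : ℝ) ≤ ⌊β * (betaT β)^[n] w⌋ := by exact_mod_cast this
    simp [digitPoly]
    positivity

lemma one_le_aeval_digitPoly {β w γ : ℝ} (hβ : 0 < β) (hw : w ∈ Set.Ico (0 : ℝ) 1)
    (hγ : 0 ≤ γ) {n : ℕ} (hn : (betaT β)^[n] w ≠ 0) (hn1 : (betaT β)^[n + 1] w = 0) :
    1 ≤ aeval γ (digitPoly β w (n + 1)) := by
  have h := aeval_digitPoly_nonneg hβ.le hw hγ n
  have h0 := (betaT_iterate_mem_Ico β hw n).1
  have hpos : 0 < β * (betaT β)^[n] w := mul_pos hβ (lt_of_le_of_ne h0 hn.symm)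
  rw [Function.iterate_succ_apply'] at hn1
  have hd : (0 : ℝ) < ⌊β * (betaT β)^[n] w⌋ := by
    have : β * (betaT β)^[n] w - ⌊β * (betaT β)^[n] w⌋ = 0 := hn1
    linarith
  have hd1 : (1 : ℝ) ≤ ⌊β * (betaT β)^[n] w⌋ := by
    have : 0 < ⌊β * (betaT β)^[n] w⌋ := by exact_mod_cast hd
    exact_mod_cast this
  have := mul_nonneg hγ h
  simp [digitPoly]
  linarith

/-- A digit `a` is followed by a digit smaller than `b`, which bounds the values of digit
polynomials at `γ`. -/
lemma aeval_digitPoly_le {a b : ℤ} {β w γ B : ℝ} (hβ0 : 0 < β) (hlt : β < a + 1)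
    (hb : β * (β - a) < b) (hba : γ + b ≤ a) (hw : w ∈ Set.Ico (0 : ℝ) 1)
    (hγ : 0 ≤ γ) (hB0 : 0 ≤ B) (hB : γ * B + (a - 1) = B) (n : ℕ) :
    aeval γ (digitPoly β w n) ≤ B ∨
      ((betaT β)^[n] w < β - a ∧ aeval γ (digitPoly β w n) ≤ B + 1) := by
  induction n with
  | zero => left; simpa [digitPoly] using hB0
  | succ n ih =>
    set t := (betaT β)^[n] w with ht
    have htm : t ∈ Set.Ico (0 : ℝ) 1 := betaT_iterate_mem_Ico β hw n
    set d := ⌊β * t⌋ with hd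
    have hs : (betaT β)^[n + 1] w = β * t - d := by
      rw [Function.iterate_succ_apply']; rfl
    have hev : aeval γ (digitPoly β w (n + 1)) = γ * aeval γ (digitPoly β w n) + d := by
      simp [digitPoly, ← ht, ← hd]
    rw [hs, hev]
    have hdt : (d : ℝ) ≤ β * t := Int.floor_le _
    have hda : d ≤ a := by
      have : (d : ℝ) < ((a + 1 : ℤ) : ℝ) := by push_cast; nlinarith [htm.2]
      have : d < a + 1 := by exact_mod_cast this
      omega
    rcases ih with h | ⟨h1, h2⟩
    · have hm := mul_le_mul_of_nonneg_left h hγ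
      rcases hda.lt_or_eq with hd' | hd'
      · left
        have : (d : ℝ) ≤ a - 1 := by
          have : d ≤ a - 1 := by omega
          exact_mod_cast this
        linarith
      · right
        rw [hd']
        constructor
        · nlinarith [htm.2]
        · linarith
    · left
      have hm := mul_le_mul_of_nonneg_left h2 hγ
      have : (d : ℝ) < b := by nlinarith
      have : (d : ℝ) ≤ b - 1 := by
        have : d < b := by exact_mod_cast this
        have : d ≤ b - 1 := by omega
        exact_mod_cast this
      linarith

lemma exists_poly_of_mem_betaInt {β γ H : ℝ} (hβ : 0 < β) (hγ : 0 ≤ γ)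
    (hH : ∀ w ∈ Set.Ico (0 : ℝ) 1, ∀ n, aeval γ (digitPoly β w n) ≤ H)
    {x : ℝ} (hx : x ∈ betaInt β) : ∃ p : ℤ[X], aeval β p = x ∧ |aeval γ p| ≤ H := by
  obtain ⟨N, h1, h2⟩ := hx
  have h := pow_mul_eq_aeval_digitPoly β (|x| / β ^ N) N
  rw [h2, add_zero, mul_div_cancel₀ _ (by positivity)] at h
  have hb : |aeval γ (digitPoly β (|x| / β ^ N) N)| ≤ H := by
    rw [abs_of_nonneg (aeval_digitPoly_nonneg hβ.le h1 hγ N)]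
    exact hH _ h1 N
  rcases abs_choice x with hx | hx
  · exact ⟨digitPoly β (|x| / β ^ N) N, by rw [← h, hx], hb⟩
  · refine ⟨-digitPoly β (|x| / β ^ N) N, ?_, by simpa using hb⟩
    rw [map_neg, ← h, hx, neg_neg]

lemma sq_mul_add_mem_betaInt {β γ H : ℝ} (hβ : 1 < β) (hγ : 0 < γ) (hγ1 : γ < 1)
    (hH : ∀ w ∈ Set.Ico (0 : ℝ) 1, ∀ n, aeval γ (digitPoly β w n) ≤ H)
    (hconj : ∀ q : ℤ[X], aeval β q = 0 → aeval γ q = 0) (hH3 : γ ^ 3 * (2 * H) < 1)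
    {x y : ℝ} (hx : x ∈ betaInt β) (hy : y ∈ betaInt β) (hz : x + y ∈ finBeta β) :
    β ^ 2 * (x + y) ∈ betaInt β := by
  have hβ0 : 0 < β := by linarith
  obtain ⟨p, hp, hpH⟩ := exists_poly_of_mem_betaInt hβ0 hγ.le hH hx
  obtain ⟨q, hq, hqH⟩ := exists_poly_of_mem_betaInt hβ0 hγ.le hH hy
  obtain ⟨N, hN⟩ := hz
  have hex : ∃ n, |x + y| / β ^ N ∈ Set.Ico (0 : ℝ) 1 ∧ (betaT β)^[n] (|x + y| / β ^ N) = 0 := hN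
  classical
  set w := |x + y| / β ^ N with hw
  have hwm : w ∈ Set.Ico (0 : ℝ) 1 := hex.choose_spec.1
  have hex' : ∃ n, (betaT β)^[n] w = 0 := ⟨_, hex.choose_spec.2⟩
  have hfind := Nat.find_spec hex'
  have hmin : ∀ m, m < Nat.find hex' → (betaT β)^[m] w ≠ 0 := fun m => Nat.find_min hex'
  generalize Nat.find hex' = n at hfind hmin
  have hle : n ≤ N + 2 := by
    by_contra! hlt
    obtain ⟨k, rfl⟩ := Nat.exists_eq_add_of_le (show N + 3 ≤ n by omega)
    have hone : 1 ≤ aeval γ (digitPoly β w (N + 3 + k)) := by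
      rw [show N + 3 + k = (N + 2 + k) + 1 by omega] at hfind ⊢
      exact one_le_aeval_digitPoly hβ0 hwm hγ.le (hmin _ (by omega)) hfind
    have hpoly := pow_mul_eq_aeval_digitPoly β w (N + 3 + k)
    have hpow : β ^ (N + 3 + k) * w = β ^ (3 + k) * |x + y| := by
      rw [hw, add_assoc, pow_add]; field_simp
    rw [hfind, add_zero, hpow] at hpoly
    have habs : aeval γ (digitPoly β w (N + 3 + k)) ≤ γ ^ (3 + k) * |aeval γ p + aeval γ q| := by
      rcases abs_choice (x + y) with h | h
      · have := hconj (X ^ (3 + k) * (p + q) - digitPoly β w (N + 3 + k)) (by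
          simp only [map_sub, map_mul, map_pow, map_add, aeval_X, hp, hq, ← hpoly, h, sub_self])
        simp only [map_sub, map_mul, map_pow, map_add, aeval_X] at this
        rw [← sub_eq_zero.1 this]
        gcongr
        exact le_abs_self _
      · have := hconj (X ^ (3 + k) * (p + q) + digitPoly β w (N + 3 + k)) (by
          simp only [map_mul, map_pow, map_add, aeval_X, hp, hq, ← hpoly, h]; ring)
        simp only [map_mul, map_pow, map_add, aeval_X] at this
        rw [eq_neg_of_add_eq_zero_right this, ← mul_neg]
        gcongr
        exact neg_le_abs _
    have h3 : γ ^ (3 + k) ≤ γ ^ 3 := pow_le_pow_of_le_one hγ.le hγ1.le (by omega)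
    have hsum : |aeval γ p + aeval γ q| ≤ 2 * H := by
      linarith [abs_add_le (aeval γ p) (aeval γ q)]
    have := mul_le_mul h3 hsum (abs_nonneg _) (by positivity)
    linarith
  have he : |β ^ 2 * (x + y)| / β ^ (N + 2) = w := by
    rw [hw, abs_mul, abs_of_pos (by positivity : 0 < β ^ 2), pow_add]; field_simp
  exact ⟨N + 2, by rwa [he], by rw [he]; exact betaT_iterate_eq_zero_of_le hle hfind⟩

lemma irreducible_cubic {a b : ℤ} (h1 : a + b ≠ 2) (h2 : a ≠ b) :
    Irreducible (X ^ 3 - C a * X ^ 2 - C b * X + 1 : ℤ[X]) := by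
  have hdeg : (X ^ 3 - C a * X ^ 2 - C b * X + 1 : ℤ[X]).natDegree = 3 := by compute_degree!
  have hm : (X ^ 3 - C a * X ^ 2 - C b * X + 1 : ℤ[X]).Monic := by monicity!
  rw [hm.irreducible_iff_roots_eq_zero_of_degree_le_three (by omega) (by omega)]
  refine Multiset.eq_zero_of_forall_notMem fun r hr => ?_
  have hr' := (mem_roots'.1 hr).2
  simp [IsRoot] at hr'
  have hdvd : r ∣ 1 := ⟨-(r ^ 2 - a * r - b), by linear_combination hr'⟩
  rcases Int.isUnit_iff.1 (isUnit_of_dvd_one hdvd) with rfl | rfl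
  · apply h1; linarith
  · apply h2; linarith

lemma aeval_conj_eq_zero {a b : ℤ} (h1 : a + b ≠ 2) (h2 : a ≠ b) {β γ : ℝ}
    (hβ : β ^ 3 - (a : ℝ) * β ^ 2 - (b : ℝ) * β + 1 = 0)
    (hγ : γ ^ 3 - (a : ℝ) * γ ^ 2 - (b : ℝ) * γ + 1 = 0) (q : ℤ[X]) (hq : aeval β q = 0) :
    aeval γ q = 0 := by
  have hirr := irreducible_cubic h1 h2
  have hm : (X ^ 3 - C a * X ^ 2 - C b * X + 1 : ℤ[X]).Monic := by monicity!
  have hβ' : aeval β (X ^ 3 - C a * X ^ 2 - C b * X + 1 : ℤ[X]) = 0 := by simpa using hβ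
  have hγ' : aeval γ (X ^ 3 - C a * X ^ 2 - C b * X + 1 : ℤ[X]) = 0 := by simpa using hγ
  have hint : IsIntegral ℤ β := ⟨_, hm, hβ'⟩
  have hd1 := minpoly.isIntegrallyClosed_dvd hint hβ'
  have hd2 := minpoly.isIntegrallyClosed_dvd hint hq
  have hass := (hirr.dvd_iff.1 hd1).resolve_left (minpoly.not_isUnit ℤ β)
  obtain ⟨r, hr⟩ := hass.dvd.trans hd2
  rw [hr, map_mul, hγ', zero_mul]

lemma exists_small_conjugate {a b : ℝ} (h : 9 / 2 < a + 2 * b) :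
    ∃ γ : ℝ, 0 < γ ∧ γ < 1 / 2 ∧ γ ^ 3 - a * γ ^ 2 - b * γ + 1 = 0 := by
  have hc : ContinuousOn (fun x : ℝ => x ^ 3 - a * x ^ 2 - b * x + 1) (Set.Icc 0 (1 / 2)) := by
    fun_prop
  obtain ⟨γ, hγ, h0⟩ := intermediate_value_Ioo' (by norm_num) hc
    (show (0 : ℝ) ∈ Set.Ioo _ _ from ⟨by norm_num; linarith, by norm_num⟩)
  exact ⟨γ, hγ.1, hγ.2, h0⟩

lemma Lplus_eq_two_of_witness {β : ℝ} (hβ : 2 ≤ β)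
    (hup : ∀ x ∈ betaInt β, ∀ y ∈ betaInt β, x + y ∈ finBeta β → β ^ 2 * (x + y) ∈ betaInt β)
    {x y : ℝ} {m : ℕ} (hx : x ∈ betaInt β) (hy : y ∈ betaInt β)
    (hxy : β ^ 2 * (x + y) = β ^ (m + 2) + 1) : Lplus β = 2 := by
  have hβ0 : 0 < β := by linarith
  have hz : x + y = β ^ m + (β ^ 2)⁻¹ := by
    field_simp
    linear_combination hxy
  have hfin : x + y ∈ finBeta β := hz ▸ pow_add_inv_sq_mem_finBeta hβ m
  have hnot : β * (x + y) ∉ betaInt β := hz ▸ mul_pow_add_inv_sq_notMem_betaInt hβ m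
  refine le_antisymm (Nat.sInf_le hup) (le_csInf ⟨2, hup⟩ fun L hL => ?_)
  by_contra! hlt
  have := hL x hx y hy hfin
  interval_cases L
  · exact hnot (mul_mem_betaInt (by linarith) (by simpa using this))
  · exact hnot (by simpa using this)

end BetaExpansion

open BetaExpansion

theorem stmt9 (a b : ℤ) (hb : 0 < b) (hba : b < a) (β : ℝ) (hβ : 1 < β)
    (hroot : β ^ 3 - (a : ℝ) * β ^ 2 - (b : ℝ) * β + 1 = 0)
    (hcase : (3 ≤ a ∧ b = 1) ∨ (4 ≤ a ∧ b = 2)) :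
    Lplus β = 2 := by
  have haZ : 3 ≤ a := by omega
  have ha : (3 : ℝ) ≤ a := by exact_mod_cast haZ
  have hbR : (1 : ℝ) ≤ b := by exact_mod_cast hb
  have hbaR : (b : ℝ) + 1 ≤ a := by exact_mod_cast hba
  have hβ0 : 0 < β := by linarith
  have hgt : (a : ℝ) < β := by
    by_contra! h
    have h1 : β ^ 2 * (β - a) ≤ 0 := mul_nonpos_of_nonneg_of_nonpos (by positivity) (by linarith)
    nlinarith
  have hprod : β * (β - a) < b := by
    have : β * (β * (β - a)) < β * b := by linarith
    exact lt_of_mul_lt_mul_left this hβ0.le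
  have hlt : β < a + 1 := by nlinarith
  obtain ⟨γ, hγ0, hγ1, hγ⟩ := exists_small_conjugate (a := (a : ℝ)) (b := b) (by linarith)
  have hB : γ * ((a - 1) / (1 - γ)) + (a - 1) = ((a : ℝ) - 1) / (1 - γ) := by
    have : 1 - γ ≠ 0 := by linarith
    field_simp
    ring
  have hB0 : 0 ≤ ((a : ℝ) - 1) / (1 - γ) := div_nonneg (by linarith) (by linarith)
  have hγb : γ + b ≤ a := by linarith
  have hH : ∀ w ∈ Set.Ico (0 : ℝ) 1, ∀ n,
      aeval γ (digitPoly β w n) ≤ ((a : ℝ) - 1) / (1 - γ) + 1 := by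
    intro w hw n
    rcases aeval_digitPoly_le hβ0 hlt hprod hγb hw hγ0.le hB0 hB n with h | h
    · linarith
    · exact h.2
  have hH3 : γ ^ 3 * (2 * (((a : ℝ) - 1) / (1 - γ) + 1)) < 1 := by
    have h1 : 0 < 1 - γ := by linarith
    have he : γ ^ 3 * (2 * (((a : ℝ) - 1) / (1 - γ) + 1)) = 2 * γ ^ 3 * (a - γ) / (1 - γ) := by
      field_simp
      ring
    rw [he, div_lt_one h1]
    have h2 : 0 < (1 - γ) * (1 - 2 * γ) := mul_pos h1 (by linarith)
    have h3 : γ ^ 2 * 1 ≤ γ ^ 2 * b := mul_le_mul_of_nonneg_left hbR (by positivity)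
    linear_combination 2 * h3 + h2 - 2 * γ * hγ
  have hup : ∀ x ∈ betaInt β, ∀ y ∈ betaInt β,
      x + y ∈ finBeta β → β ^ 2 * (x + y) ∈ betaInt β := fun x hx y hy hxy =>
    sq_mul_add_mem_betaInt hβ hγ0 (by linarith) hH
      (aeval_conj_eq_zero (by omega) (by omega) hroot hγ) hH3 hx hy hxy
  have h1a : (a : ℝ) < β ^ (0 + 1) := by simpa using hgt
  have hdigit_a : HasDigits β 1 a := by
    have := (hasDigits_zero β).cons hβ (d := a) (by omega) (by simpa using hgt)
    simpa using this
  rcases hcase with ⟨-, rfl⟩ | ⟨ha4, rfl⟩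
  · have hone : HasDigits β 1 1 := by
      have := (hasDigits_zero β).cons hβ (d := 1) (by omega) (by simpa using hβ)
      simpa using this
    have hx := hone.cons hβ (d := a - 1) (by omega) (by push_cast; nlinarith)
    refine Lplus_eq_two_of_witness (m := 2) (by linarith) hup (hx.mem_betaInt hβ)
      (hdigit_a.mem_betaInt hβ) ?_
    push_cast at hroot ⊢
    linear_combination (-β - 1) * hroot
  · have ha4R : (4 : ℝ) ≤ a := by exact_mod_cast ha4
    have hβ4 : 4 < β := by linarith
    have hfour : HasDigits β 1 4 := by
      have := (hasDigits_zero β).cons hβ (d := 4) (by omega) (by simpa using hβ4)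
      simpa using this
    have hx2 : ((a : ℝ) - 1) * β + a < β ^ 2 := by nlinarith
    have hy2 : ((a : ℝ) - 1) * β + 4 < β ^ 2 := by linarith
    have h23 : β ^ 2 < β ^ 3 := pow_lt_pow_right₀ hβ (by norm_num)
    have h34 : (a : ℝ) * β ^ 3 < β ^ 4 := by
      rw [pow_succ' β 3]; exact mul_lt_mul_of_pos_right hgt (by positivity)
    have h34' : 2 * β ^ 3 ≤ a * β ^ 3 := by gcongr; linarith
    have hx := ((hdigit_a.cons hβ (d := a - 1) (by omega) (by push_cast; linarith)).cons hβ
      (d := 0) le_rfl (by push_cast; linarith)).cons hβ (d := a - 1) (by omega)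
      (by push_cast; linarith)
    have hy := ((hfour.cons hβ (d := a - 1) (by omega) (by push_cast; linarith)).cons hβ
      (d := 0) le_rfl (by push_cast; linarith)).cons hβ (d := 1) (by omega)
      (by push_cast; linarith)
    refine Lplus_eq_two_of_witness (m := 4) (by linarith) hup (hx.mem_betaInt hβ)
      (hy.mem_betaInt hβ) ?_
    push_cast at hroot ⊢
    linear_combination (-β ^ 3 - 2 * β - 1) * hroot
end
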